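/- arXiv:2312.00439 — 6 statements merged into one kernel-verified Lean document; each statement's English description precedes it below -/
import Mathlib

section
/- For every real θ ≠ 0 and every a ∈ [0,1], the Frank copula density integrates to one in its second argument: ∫₀¹ c_θ(a,s) ds = 1. -/
/-- The Frank copula density `c_θ(a,b)`. -/
noncomputable def frankDensity (θ a b : ℝ) : ℝ :=
  (-θ * Real.exp (-θ * a) * Real.exp (-θ * b) * (Real.exp (-θ) - 1)) /
    ((Real.exp (-θ) - 1) + (Real.exp (-θ * a) - 1) * (Real.exp (-θ * b) - 1)) ^ 2

theorem frank_denom_ne (θ : ℝ) (hθ : θ ≠ 0) (a s : ℝ) (ha : a ∈ Set.Icc (0 : ℝ) 1)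
    (hs : s ∈ Set.Icc (0 : ℝ) 1) :
    (Real.exp (-θ) - 1) + (Real.exp (-θ * a) - 1) * (Real.exp (-θ * s) - 1) ≠ 0 := by
  obtain ⟨ha0, ha1⟩ := ha
  obtain ⟨hs0, hs1⟩ := hs
  rcases lt_or_gt_of_ne hθ with h | h
  · have h1 : 1 < Real.exp (-θ) := Real.one_lt_exp_iff.2 (by linarith)
    have h2 : 1 ≤ Real.exp (-θ * a) := Real.one_le_exp (by nlinarith)
    have h3 : 1 ≤ Real.exp (-θ * s) := Real.one_le_exp (by nlinarith)
    have := mul_nonneg (sub_nonneg.2 h2) (sub_nonneg.2 h3)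
    linarith
  · have h1 : Real.exp (-θ) < 1 := Real.exp_lt_one_iff.2 (by linarith)
    have h2 : Real.exp (-θ) ≤ Real.exp (-θ * a) := Real.exp_le_exp.2 (by nlinarith)
    have h3 : Real.exp (-θ * s) ≤ 1 := Real.exp_le_one_iff.2 (by nlinarith)
    have h4 := Real.exp_pos (-θ * s)
    have h5 := mul_nonneg (sub_nonneg.2 h2) (sub_nonneg.2 h3)
    have h6 := mul_pos (sub_pos.2 h1) h4
    nlinarith

/-- For every real `θ ≠ 0` and every `a ∈ [0,1]`, the Frank copula density integrates
to one in its second argument: `∫₀¹ c_θ(a,s) ds = 1`. -/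
theorem frankDensity_integral_eq_one (θ : ℝ) (hθ : θ ≠ 0) (a : ℝ)
    (ha : a ∈ Set.Icc (0 : ℝ) 1) :
    ∫ s in (0 : ℝ)..1, frankDensity θ a s = 1 := by
  have hne : ∀ s ∈ Set.uIcc (0 : ℝ) 1, (Real.exp (-θ) - 1) +
      (Real.exp (-θ * a) - 1) * (Real.exp (-θ * s) - 1) ≠ 0 := by
    intro s hs
    rw [Set.uIcc_of_le zero_le_one] at hs
    exact frank_denom_ne θ hθ a s ha hs
  have hD : ∀ s ∈ Set.uIcc (0 : ℝ) 1, HasDerivAt (fun s => Real.exp (-θ * a) *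
      (Real.exp (-θ * s) - 1) / ((Real.exp (-θ) - 1) +
      (Real.exp (-θ * a) - 1) * (Real.exp (-θ * s) - 1))) (frankDensity θ a s) s := by
    intro s hs
    have hy : HasDerivAt (fun s => Real.exp (-θ * s) - 1) (Real.exp (-θ * s) * (-θ * 1)) s :=
      (((hasDerivAt_id s).const_mul (-θ)).exp).sub_const 1
    have h := (hy.const_mul (Real.exp (-θ * a))).div
      ((hy.const_mul (Real.exp (-θ * a) - 1)).const_add (Real.exp (-θ) - 1)) (hne s hs)
    refine h.congr_deriv ?_
    unfold frankDensity
    congr 1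
    ring
  rw [intervalIntegral.integral_eq_sub_of_hasDerivAt hD]
  · have h1 := hne 1 (by simp)
    simp only [mul_one, mul_zero, Real.exp_zero, sub_self, zero_div, sub_zero] at h1 ⊢
    rw [div_eq_one_iff_eq h1]
    ring
  · apply ContinuousOn.intervalIntegrable
    unfold frankDensity
    apply ContinuousOn.div
    · fun_prop
    · fun_prop
    · intro s hs
      exact pow_ne_zero 2 (hne s hs)
end

section
/- For every real θ ≠ 0 and all rectangles [u₁,u₂] × [v₁,v₂] ⊆ [0,1]², the Frank copula is 2-increasing: C_θ(u₂,v₂) − C_θ(u₁,v₂) − C_θ(u₂,v₁) + C_θ(u₁,v₁) ≥ 0, where u₁ ≤ u₂ and v₁ ≤ v₂. -/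
/-- The Frank copula `C_θ(u,v)`. -/
noncomputable def frankCopula (θ u v : ℝ) : ℝ :=
  -(1 / θ) * Real.log (1 +
    (Real.exp (-θ * u) - 1) * (Real.exp (-θ * v) - 1) / (Real.exp (-θ) - 1))

theorem frank_arg_pos (θ u v : ℝ) (hθ : θ ≠ 0) (hu : u ∈ Set.Icc (0 : ℝ) 1) :
    0 < 1 + (Real.exp (-θ * u) - 1) * (Real.exp (-θ * v) - 1) / (Real.exp (-θ) - 1) := by
  obtain ⟨h0, h1⟩ := hu
  have hb : 0 < Real.exp (-θ * v) := Real.exp_pos _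
  have ht : 0 ≤ (Real.exp (-θ * u) - 1) / (Real.exp (-θ) - 1) ∧
      (Real.exp (-θ * u) - 1) / (Real.exp (-θ) - 1) ≤ 1 := by
    rcases lt_or_gt_of_ne hθ with h | h
    · have hd : 1 < Real.exp (-θ) := Real.one_lt_exp_iff.2 (by linarith)
      have ha : 1 ≤ Real.exp (-θ * u) := Real.one_le_exp (by nlinarith)
      have hc : Real.exp (-θ * u) ≤ Real.exp (-θ) := Real.exp_le_exp.2 (by nlinarith)
      exact ⟨div_nonneg (by linarith) (by linarith), (div_le_one (by linarith)).2 (by linarith)⟩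
    · have hd : Real.exp (-θ) < 1 := Real.exp_lt_one_iff.2 (by linarith)
      have ha : Real.exp (-θ * u) ≤ 1 := Real.exp_le_one_iff.2 (by nlinarith)
      have hc : Real.exp (-θ) ≤ Real.exp (-θ * u) := Real.exp_le_exp.2 (by nlinarith)
      exact ⟨div_nonneg_of_nonpos (by linarith) (by linarith),
        (div_le_one_of_neg (by linarith)).2 (by linarith)⟩
  rw [mul_div_right_comm]
  generalize (Real.exp (-θ * u) - 1) / (Real.exp (-θ) - 1) = t at *
  obtain ⟨ht0, ht1⟩ := ht
  rcases eq_or_lt_of_le ht0 with h | h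
  · rw [← h]; norm_num
  · nlinarith [mul_pos h hb]

/-- For every `θ ≠ 0`, the Frank copula is 2-increasing: for every rectangle
`[u₁,u₂] × [v₁,v₂] ⊆ [0,1]²` (with `u₁ ≤ u₂`, `v₁ ≤ v₂`), the copula volume
of the rectangle is nonnegative. -/
theorem frankCopula_two_increasing (θ : ℝ) (hθ : θ ≠ 0)
    (u₁ u₂ v₁ v₂ : ℝ) (hu₁ : u₁ ∈ Set.Icc (0 : ℝ) 1) (hu₂ : u₂ ∈ Set.Icc (0 : ℝ) 1)
    (hv₁ : v₁ ∈ Set.Icc (0 : ℝ) 1) (hv₂ : v₂ ∈ Set.Icc (0 : ℝ) 1)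
    (hu : u₁ ≤ u₂) (hv : v₁ ≤ v₂) :
    0 ≤ frankCopula θ u₂ v₂ - frankCopula θ u₁ v₂ - frankCopula θ u₂ v₁ +
      frankCopula θ u₁ v₁ := by
  have p22 := frank_arg_pos θ u₂ v₂ hθ hu₂
  have p12 := frank_arg_pos θ u₁ v₂ hθ hu₁
  have p21 := frank_arg_pos θ u₂ v₁ hθ hu₂
  have p11 := frank_arg_pos θ u₁ v₁ hθ hu₁
  unfold frankCopula
  rcases lt_or_gt_of_ne hθ with h | h
  · have hd : 1 < Real.exp (-θ) := Real.one_lt_exp_iff.2 (by linarith)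
    have ha : Real.exp (-θ * u₁) ≤ Real.exp (-θ * u₂) := Real.exp_le_exp.2 (by nlinarith)
    have hb : Real.exp (-θ * v₁) ≤ Real.exp (-θ * v₂) := Real.exp_le_exp.2 (by nlinarith)
    have key : 0 ≤ (Real.exp (-θ * u₂) - Real.exp (-θ * u₁)) *
        (Real.exp (-θ * v₂) - Real.exp (-θ * v₁)) / (Real.exp (-θ) - 1) :=
      div_nonneg (mul_nonneg (by linarith) (by linarith)) (by linarith)
    have hid : (1 + (Real.exp (-θ * u₂) - 1) * (Real.exp (-θ * v₂) - 1) / (Real.exp (-θ) - 1)) *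
        (1 + (Real.exp (-θ * u₁) - 1) * (Real.exp (-θ * v₁) - 1) / (Real.exp (-θ) - 1)) -
        (1 + (Real.exp (-θ * u₁) - 1) * (Real.exp (-θ * v₂) - 1) / (Real.exp (-θ) - 1)) *
        (1 + (Real.exp (-θ * u₂) - 1) * (Real.exp (-θ * v₁) - 1) / (Real.exp (-θ) - 1)) =
        (Real.exp (-θ * u₂) - Real.exp (-θ * u₁)) *
        (Real.exp (-θ * v₂) - Real.exp (-θ * v₁)) / (Real.exp (-θ) - 1) := by ring
    have hl := Real.log_le_log (mul_pos p12 p21) (sub_nonneg.1 (hid ▸ key))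
    rw [Real.log_mul p12.ne' p21.ne', Real.log_mul p22.ne' p11.ne'] at hl
    have hi : 0 < -(1 / θ) := by
      have := one_div_neg.2 h
      linarith
    have := mul_nonneg hi.le (sub_nonneg.2 hl)
    linarith
  · have hd : Real.exp (-θ) < 1 := Real.exp_lt_one_iff.2 (by linarith)
    have ha : Real.exp (-θ * u₂) ≤ Real.exp (-θ * u₁) := Real.exp_le_exp.2 (by nlinarith)
    have hb : Real.exp (-θ * v₂) ≤ Real.exp (-θ * v₁) := Real.exp_le_exp.2 (by nlinarith)
    have key : (Real.exp (-θ * u₂) - Real.exp (-θ * u₁)) *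
        (Real.exp (-θ * v₂) - Real.exp (-θ * v₁)) / (Real.exp (-θ) - 1) ≤ 0 :=
      div_nonpos_of_nonneg_of_nonpos
        (mul_nonneg_of_nonpos_of_nonpos (by linarith) (by linarith)) (by linarith)
    have hid : (1 + (Real.exp (-θ * u₂) - 1) * (Real.exp (-θ * v₂) - 1) / (Real.exp (-θ) - 1)) *
        (1 + (Real.exp (-θ * u₁) - 1) * (Real.exp (-θ * v₁) - 1) / (Real.exp (-θ) - 1)) -
        (1 + (Real.exp (-θ * u₁) - 1) * (Real.exp (-θ * v₂) - 1) / (Real.exp (-θ) - 1)) *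
        (1 + (Real.exp (-θ * u₂) - 1) * (Real.exp (-θ * v₁) - 1) / (Real.exp (-θ) - 1)) =
        (Real.exp (-θ * u₂) - Real.exp (-θ * u₁)) *
        (Real.exp (-θ * v₂) - Real.exp (-θ * v₁)) / (Real.exp (-θ) - 1) := by ring
    have hl := Real.log_le_log (mul_pos p22 p11) (sub_nonpos.1 (hid ▸ key))
    rw [Real.log_mul p12.ne' p21.ne', Real.log_mul p22.ne' p11.ne'] at hl
    have hi : 0 < 1 / θ := one_div_pos.2 h
    have := mul_nonneg hi.le (sub_nonneg.2 hl)
    linarith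
end

section
/- For every real θ ≠ 0, Kendall's rank correlation coefficient of the Frank copula satisfies the identity 4 · ∫₀¹∫₀¹ C_θ(u,v) · c_θ(u,v) du dv − 1 = 1 + (4/θ) · ( (1/θ) · ∫₀^θ t/(exp(t)−1) dt − 1 ), where for θ < 0 the integral ∫₀^θ is understood as the oriented integral and the integrand t ↦ t/(exp(t)−1) is extended continuously by the value 1 at t = 0. -/
/-- The integrand `t ↦ t/(exp t − 1)`, extended continuously by `1` at `t = 0`. -/
noncomputable def debyeIntegrand (t : ℝ) : ℝ :=
  if t = 0 then 1 else t / (Real.exp t - 1)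

theorem debye_cont : Continuous debyeIntegrand := by
  have h : debyeIntegrand = fun t => (dslope Real.exp 0 t)⁻¹ := by
    funext t
    unfold debyeIntegrand
    split_ifs with h
    · subst h; simp [dslope_same]
    · rw [dslope_of_ne _ h, slope_def_field]; simp
  rw [h]
  have hc : Continuous (dslope Real.exp 0) := by
    rw [← continuousOn_univ, continuousOn_dslope Filter.univ_mem]
    exact ⟨Real.continuous_exp.continuousOn, Real.differentiable_exp.differentiableAt⟩
  refine hc.inv₀ fun t => ?_
  by_cases h : t = 0
  · subst h; simp [dslope_same]
  · rw [dslope_of_ne _ h, slope_def_field]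
    simp [sub_eq_zero, h]

theorem debye_neg (t : ℝ) : debyeIntegrand (-t) = t + debyeIntegrand t := by
  unfold debyeIntegrand
  by_cases h : t = 0
  · simp [h]
  · have h1 : Real.exp t - 1 ≠ 0 := by simp [sub_eq_zero, h]
    have h2 : 1 - Real.exp t ≠ 0 := by
      intro h'; apply h1; linarith
    have h3 := Real.exp_pos t
    simp only [neg_eq_zero, h, if_false, Real.exp_neg]
    have h4 : (Real.exp t)⁻¹ - 1 = -(Real.exp t - 1) / Real.exp t := by field_simp; ring
    rw [h4]
    field_simp
    ring

theorem s_bounds (θ : ℝ) (hθ : θ ≠ 0) (v : ℝ) (hv : v ∈ Set.Icc (0:ℝ) 1) :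
    0 ≤ (Real.exp (-θ * v) - 1) / (Real.exp (-θ) - 1) ∧
    (Real.exp (-θ * v) - 1) / (Real.exp (-θ) - 1) ≤ 1 := by
  obtain ⟨h0, h1⟩ := hv
  rcases lt_or_gt_of_ne hθ with h | h
  · have hg : 0 < Real.exp (-θ) - 1 := by simp [h]
    have ha : 0 ≤ Real.exp (-θ * v) - 1 := by
      have : 0 ≤ -θ * v := by nlinarith
      simpa using this
    have hb : Real.exp (-θ * v) ≤ Real.exp (-θ) := Real.exp_le_exp.2 (by nlinarith)
    exact ⟨div_nonneg ha hg.le, (div_le_one hg).2 (by linarith)⟩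
  · have hg : Real.exp (-θ) - 1 < 0 := by simp [h]
    have ha : Real.exp (-θ * v) - 1 ≤ 0 := by
      have : -θ * v ≤ 0 := by nlinarith
      simpa using this
    have hb : Real.exp (-θ) ≤ Real.exp (-θ * v) := Real.exp_le_exp.2 (by nlinarith)
    exact ⟨div_nonneg_of_nonpos ha hg.le, (div_le_one_of_neg hg).2 (by linarith)⟩

theorem inner_int (θ : ℝ) (hθ : θ ≠ 0) (u : ℝ) (hu : u ≠ 0) :
    (∫ v in (0 : ℝ)..1, frankCopula θ u v * frankDensity θ u v) =
      (debyeIntegrand (-(θ * u)) - 1) / θ := by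
  have hθu : θ * u ≠ 0 := mul_ne_zero hθ hu
  have hg : Real.exp (-θ) - 1 ≠ 0 := by simp [sub_eq_zero, hθ]
  have ha : Real.exp (-θ * u) - 1 ≠ 0 := by simp [sub_eq_zero, hθ, hu]
  have hxp := Real.exp_pos (-θ * u)
  have hlog : Real.log (Real.exp (-θ * u)) = -θ * u := Real.log_exp _
  have hdeb : debyeIntegrand (-(θ * u)) = (-θ * u) / (Real.exp (-θ * u) - 1) := by
    unfold debyeIntegrand
    rw [if_neg (neg_ne_zero.2 hθu), neg_mul]
  rw [hdeb]
  have hW : ∀ v ∈ Set.Icc (0:ℝ) 1, 0 < 1 +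
    (Real.exp (-θ * u) - 1) * (Real.exp (-θ * v) - 1) / (Real.exp (-θ) - 1) := by
    intro v hv
    obtain ⟨h0, h1⟩ := s_bounds θ hθ v hv
    rw [mul_div_assoc]
    generalize (Real.exp (-θ * v) - 1) / (Real.exp (-θ) - 1) = s at *
    rcases eq_or_lt_of_le h0 with h | h
    · rw [← h]; norm_num
    · nlinarith [mul_pos h hxp]
  unfold frankCopula frankDensity
  generalize Real.exp (-θ * u) = x at *
  have hD : ∀ v ∈ Set.Icc (0:ℝ) 1,
      (Real.exp (-θ) - 1) + (x - 1) * (Real.exp (-θ * v) - 1) ≠ 0 := by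
    intro v hv h
    have := (hW v hv).ne'
    apply this
    rw [eq_neg_of_add_eq_zero_right h, neg_div, div_self hg, add_neg_cancel]
  have key := intervalIntegral.integral_eq_sub_of_hasDerivAt (a := 0) (b := 1)
    (f := fun v => (1 / θ) * (x / (x - 1)) *
      ((Real.log (1 + (x - 1) * (Real.exp (-θ * v) - 1) / (Real.exp (-θ) - 1)) + 1) /
        (1 + (x - 1) * (Real.exp (-θ * v) - 1) / (Real.exp (-θ) - 1))))
    (f' := fun v => -(1 / θ) * Real.log (1 + (x - 1) * (Real.exp (-θ * v) - 1) / (Real.exp (-θ) - 1)) *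
      ((-θ * x * Real.exp (-θ * v) * (Real.exp (-θ) - 1)) /
    ((Real.exp (-θ) - 1) + (x - 1) * (Real.exp (-θ * v) - 1)) ^ 2)) ?_ ?_
  · rw [key]
    simp only [mul_one, mul_zero, Real.exp_zero, sub_self, zero_div, add_zero, Real.log_one]
    rw [mul_div_cancel_right₀ _ hg, add_sub_cancel, hlog]
    field_simp
    ring
  · intro v hv
    rw [Set.uIcc_of_le zero_le_one] at hv
    have hWv := (hW v hv).ne'
    have hDv := hD v hv
    have h1 : HasDerivAt (fun v : ℝ => 1 + (x - 1) * (Real.exp (-θ * v) - 1) / (Real.exp (-θ) - 1))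
        ((x - 1) * (Real.exp (-θ * v) * (-θ * 1)) / (Real.exp (-θ) - 1)) v :=
      ((((((hasDerivAt_id v).const_mul (-θ)).exp).sub_const 1).const_mul (x - 1)).div_const _).const_add 1
    have h2 := (((h1.log hWv).add_const 1).div h1 hWv).const_mul ((1 / θ) * (x / (x - 1)))
    refine h2.congr_deriv ?_
    have hWD : 1 + (x - 1) * (Real.exp (-θ * v) - 1) / (Real.exp (-θ) - 1) =
      ((Real.exp (-θ) - 1) + (x - 1) * (Real.exp (-θ * v) - 1)) / (Real.exp (-θ) - 1) := by
      field_simp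
    generalize Real.log (1 + (x - 1) * (Real.exp (-θ * v) - 1) / (Real.exp (-θ) - 1)) = L
    rw [hWD]
    generalize (Real.exp (-θ) - 1) + (x - 1) * (Real.exp (-θ * v) - 1) = D at *
    generalize Real.exp (-θ) - 1 = g at *
    generalize Real.exp (-θ * v) = y at *
    field_simp
    ring
  · apply ContinuousOn.intervalIntegrable
    rw [Set.uIcc_of_le zero_le_one]
    refine ContinuousOn.mul (ContinuousOn.mul continuousOn_const (ContinuousOn.log ?_ ?_))
      (ContinuousOn.div ?_ ?_ ?_)
    · fun_prop
    · intro v hv; exact (hW v hv).ne'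
    · fun_prop
    · fun_prop
    · intro v hv; exact pow_ne_zero 2 (hD v hv)

/-- Kendall's rank correlation coefficient of the Frank copula: for every `θ ≠ 0`,
`4·∫₀¹∫₀¹ C_θ(u,v)·c_θ(u,v) du dv − 1 = 1 + (4/θ)·((1/θ)·∫₀^θ t/(eᵗ−1) dt − 1)`,
where for `θ < 0` the integral `∫₀^θ` is the oriented (interval) integral. -/
theorem frank_kendall_tau (θ : ℝ) (hθ : θ ≠ 0) :
    4 * (∫ u in (0 : ℝ)..1, ∫ v in (0 : ℝ)..1,
          frankCopula θ u v * frankDensity θ u v) - 1 =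
      1 + (4 / θ) * ((1 / θ) * (∫ t in (0 : ℝ)..θ, debyeIntegrand t) - 1) := by
  have h1 : (∫ u in (0 : ℝ)..1, ∫ v in (0 : ℝ)..1,
          frankCopula θ u v * frankDensity θ u v) =
      ∫ u in (0 : ℝ)..1, ((u - 1 / θ) + (1 / θ) * debyeIntegrand (θ * u)) := by
    apply intervalIntegral.integral_congr_ae
    filter_upwards with u hu
    rw [Set.uIoc_of_le zero_le_one] at hu
    rw [inner_int θ hθ u hu.1.ne', debye_neg]
    field_simp
    ring
  have hc : Continuous fun u : ℝ => (1 / θ) * debyeIntegrand (θ * u) :=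
    continuous_const.mul (debye_cont.comp (continuous_const.mul continuous_id))
  have hc2 : Continuous fun u : ℝ => u - 1 / θ := by fun_prop
  rw [h1, intervalIntegral.integral_add (hc2.intervalIntegrable _ _) (hc.intervalIntegrable _ _),
    intervalIntegral.integral_const_mul, intervalIntegral.integral_comp_mul_left _ hθ,
    intervalIntegral.integral_sub ((by fun_prop : Continuous fun x : ℝ => x).intervalIntegrable _ _)
      (continuous_const.intervalIntegrable _ _)]
  simp only [integral_id, intervalIntegral.integral_const, mul_zero, mul_one, smul_eq_mul]
  field_simp
  ring
end

section
/- The function τ : ℝ \ {0} → ℝ defined by τ(θ) = 1 + (4/θ) · ( (1/θ) · ∫₀^θ t/(exp(t)−1) dt − 1 ) is monotone increasing in θ (on each of the intervals (−∞,0) and (0,∞), and τ(θ₁) ≤ τ(θ₂) whenever θ₁ < 0 < θ₂), where the integrand t ↦ t/(exp(t)−1) is extended continuously by the value 1 at t = 0 and for θ < 0 the integral is oriented. -/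
/-- Kendall's rank correlation coefficient of the Frank copula with association
parameter `θ ≠ 0`; for `θ < 0` the integral `∫₀^θ` is the oriented (interval) integral. -/
noncomputable def frankTau (θ : ℝ) : ℝ :=
  1 + (4 / θ) * ((1 / θ) * (∫ t in (0 : ℝ)..θ, debyeIntegrand t) - 1)

noncomputable def frankAux (x : ℝ) : ℝ :=
  if x = 0 then 0 else 1 / 2 + 1 / (Real.exp x - 1) - 1 / x

lemma frank_exp_ne {x : ℝ} (hx : x ≠ 0) : Real.exp x - 1 ≠ 0 := by
  intro h
  exact hx (Real.exp_eq_one_iff x |>.1 (by linarith))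

lemma frankAux_odd (x : ℝ) : frankAux (-x) = - frankAux x := by
  unfold frankAux
  by_cases hx : x = 0
  · simp [hx]
  · have h1 := frank_exp_ne hx
    have h0 := (Real.exp_pos x).ne'
    rw [if_neg (neg_ne_zero.2 hx), if_neg hx, Real.exp_neg]
    have h2 : (Real.exp x)⁻¹ - 1 = -(Real.exp x - 1) / Real.exp x := by
      field_simp
      ring
    rw [h2]
    have h3 : 1 / (-(Real.exp x - 1) / Real.exp x) = -1 - 1 / (Real.exp x - 1) := by
      rw [one_div_div, div_eq_iff (neg_ne_zero.2 h1)]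
      field_simp
      ring
    rw [h3]
    have : 1 / (-x) = - (1 / x) := by rw [div_neg]
    rw [this]
    ring

lemma frankAux_nonneg {x : ℝ} (hx : 0 < x) : 0 ≤ frankAux x := by
  have hm : MonotoneOn (fun y : ℝ => y * Real.exp y + y - 2 * Real.exp y + 2) (Set.Ici 0) := by
    have hd : ∀ y : ℝ, HasDerivAt (fun y : ℝ => y * Real.exp y + y - 2 * Real.exp y + 2)
        (1 * Real.exp y + y * Real.exp y + 1 - 2 * Real.exp y) y := fun y =>
      (((((hasDerivAt_id y).mul (Real.hasDerivAt_exp y)).add (hasDerivAt_id y)).sub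
        ((Real.hasDerivAt_exp y).const_mul 2)).add_const 2)
    apply monotoneOn_of_deriv_nonneg (convex_Ici 0)
    · exact fun y _ => (hd y).continuousAt.continuousWithinAt
    · exact fun y _ => (hd y).differentiableAt.differentiableWithinAt
    · intro y _
      rw [(hd y).deriv]
      have h1 := Real.add_one_le_exp (-y)
      have h2 := mul_le_mul_of_nonneg_right h1 (Real.exp_pos y).le
      rw [← Real.exp_add] at h2
      simp at h2
      linarith
  have h := hm (Set.mem_Ici.2 le_rfl) (Set.mem_Ici.2 hx.le) hx.le
  simp at h
  have he : 0 < Real.exp x - 1 := by linarith [Real.add_one_lt_exp hx.ne']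
  unfold frankAux
  rw [if_neg hx.ne']
  have : 1 / 2 + 1 / (Real.exp x - 1) - 1 / x
      = (x * Real.exp x + x - 2 * Real.exp x + 2) / (2 * x * (Real.exp x - 1)) := by
    field_simp
    ring
  rw [this]
  apply div_nonneg
  · linarith
  · positivity

lemma frank_sq {x : ℝ} (hx : 0 < x) : x ^ 2 * Real.exp x ≤ (Real.exp x - 1) ^ 2 := by
  have h1 : x / 2 ≤ Real.sinh (x / 2) := Real.self_le_sinh_iff.2 (by positivity)
  rw [Real.sinh_eq] at h1
  have e : Real.exp x = Real.exp (x / 2) ^ 2 := by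
    rw [← Real.exp_nat_mul]; congr 1; push_cast; ring
  have h0 := Real.exp_pos (x / 2)
  have h2 : x * Real.exp (x / 2) ≤ Real.exp x - 1 := by
    have h3 : x ≤ Real.exp (x/2) - Real.exp (-(x/2)) := by linarith
    have h4 := mul_le_mul_of_nonneg_right h3 h0.le
    rw [sub_mul, ← Real.exp_add (-(x/2))] at h4
    simp at h4
    rw [e]
    linarith
  calc x ^ 2 * Real.exp x = (x * Real.exp (x / 2)) ^ 2 := by rw [e]; ring
    _ ≤ _ := by gcongr

lemma frankAux_mono_pos : MonotoneOn frankAux (Set.Ioi 0) := by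
  have hm : MonotoneOn (fun y : ℝ => 1 / 2 + (Real.exp y - 1)⁻¹ - y⁻¹) (Set.Ioi 0) := by
    have hd : ∀ y : ℝ, y ≠ 0 → HasDerivAt (fun y : ℝ => 1 / 2 + (Real.exp y - 1)⁻¹ - y⁻¹)
        (-(Real.exp y) / (Real.exp y - 1) ^ 2 - -(y ^ 2)⁻¹) y := fun y hy =>
      ((((Real.hasDerivAt_exp y).sub_const 1).inv (frank_exp_ne hy)).const_add (1/2)).sub
        (hasDerivAt_inv hy)
    apply monotoneOn_of_deriv_nonneg (convex_Ioi 0)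
    · exact fun y hy => (hd y (ne_of_gt hy)).continuousAt.continuousWithinAt
    · rw [interior_Ioi]
      exact fun y hy => (hd y (ne_of_gt hy)).differentiableAt.differentiableWithinAt
    · rw [interior_Ioi]
      intro y hy
      have hy : 0 < y := hy
      rw [(hd y hy.ne').deriv]
      have h1 := frank_sq hy
      have h2 : 0 < (Real.exp y - 1) ^ 2 := by
        have := frank_exp_ne hy.ne'
        positivity
      have h3 : Real.exp y / (Real.exp y - 1) ^ 2 ≤ (y ^ 2)⁻¹ := by
        rw [inv_eq_one_div, div_le_div_iff₀ h2 (by positivity)]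
        linarith
      rw [neg_div]
      linarith
  intro a ha b hb hab
  have := hm ha hb hab
  simp only [frankAux, if_neg (ne_of_gt (Set.mem_Ioi.1 ha)), if_neg (ne_of_gt (Set.mem_Ioi.1 hb)),
    one_div] at this ⊢
  exact this

lemma frankAux_mono : Monotone frankAux := by
  apply monotone_of_odd_of_monotoneOn_nonneg frankAux_odd
  intro a ha b hb hab
  rcases (Set.mem_Ici.1 ha).eq_or_lt with h | h
  · subst h
    rcases (Set.mem_Ici.1 hb).eq_or_lt with h | h
    · subst h; exact le_rfl
    · have : frankAux 0 = 0 := by simp [frankAux]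
      rw [this]
      exact frankAux_nonneg h
  · exact frankAux_mono_pos h (h.trans_le hab) hab

lemma debye_eq (t : ℝ) : debyeIntegrand t = (1 - t / 2) + t * frankAux t := by
  unfold debyeIntegrand frankAux
  by_cases h : t = 0
  · simp [h]
  · have := frank_exp_ne h
    rw [if_neg h, if_neg h]
    field_simp
    ring

lemma frankTau_eq {θ : ℝ} (hθ : θ ≠ 0) :
    frankTau θ = 4 * ∫ s in (0:ℝ)..1, s * frankAux (θ * s) := by
  have hi : IntervalIntegrable (fun t => t * frankAux t) MeasureTheory.volume 0 θ :=
    (frankAux_mono.intervalIntegrable).continuousOn_mul continuousOn_id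
  have h1 : (∫ t in (0:ℝ)..θ, debyeIntegrand t)
      = (θ - θ ^ 2 / 4) + ∫ t in (0:ℝ)..θ, t * frankAux t := by
    simp_rw [debye_eq]
    rw [intervalIntegral.integral_add (Continuous.intervalIntegrable (by fun_prop) _ _) hi,
      intervalIntegral.integral_sub (by simp) (Continuous.intervalIntegrable (by fun_prop) _ _),
      intervalIntegral.integral_div, integral_id]
    simp
    ring
  have h2 : (∫ t in (0:ℝ)..θ, t * frankAux t)
      = θ ^ 2 * ∫ s in (0:ℝ)..1, s * frankAux (θ * s) := by
    have := intervalIntegral.mul_integral_comp_mul_left (a := 0) (b := 1)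
      (f := fun t => t * frankAux t) θ
    simp only [mul_zero, mul_one] at this
    rw [← this]
    simp_rw [mul_assoc]
    rw [intervalIntegral.integral_const_mul]
    ring
  unfold frankTau
  rw [h1, h2]
  field_simp
  ring

lemma frankTau_le {a b : ℝ} (ha : a ≠ 0) (hb : b ≠ 0) (hab : a ≤ b) :
    frankTau a ≤ frankTau b := by
  rw [frankTau_eq ha, frankTau_eq hb]
  have hi : ∀ θ : ℝ, IntervalIntegrable (fun s => s * frankAux (θ * s))
      MeasureTheory.volume 0 1 := by
    intro θ
    refine IntervalIntegrable.continuousOn_mul ?_ continuousOn_id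
    rcases le_total 0 θ with h | h
    · exact Monotone.intervalIntegrable
        (fun x y hxy => frankAux_mono (mul_le_mul_of_nonneg_left hxy h))
    · exact Antitone.intervalIntegrable
        (fun x y hxy => frankAux_mono (mul_le_mul_of_nonpos_left hxy h))
  have := intervalIntegral.integral_mono_on zero_le_one (hi a) (hi b) (fun s hs =>
    mul_le_mul_of_nonneg_left (frankAux_mono (mul_le_mul_of_nonneg_right hab hs.1)) hs.1)
  linarith

/-- `τ` is monotone increasing in `θ`: on each of the intervals `(−∞,0)` and `(0,∞)`,
and `τ(θ₁) ≤ τ(θ₂)` whenever `θ₁ < 0 < θ₂`. -/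
theorem frankTau_monotone :
    (∀ θ₁ θ₂ : ℝ, θ₁ < θ₂ → θ₂ < 0 → frankTau θ₁ ≤ frankTau θ₂) ∧
    (∀ θ₁ θ₂ : ℝ, 0 < θ₁ → θ₁ < θ₂ → frankTau θ₁ ≤ frankTau θ₂) ∧
    (∀ θ₁ θ₂ : ℝ, θ₁ < 0 → 0 < θ₂ → frankTau θ₁ ≤ frankTau θ₂) := by
  refine ⟨fun a b h1 h2 => ?_, fun a b h1 h2 => ?_, fun a b h1 h2 => ?_⟩
  · exact frankTau_le (h1.trans h2).ne h2.ne h1.le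
  · exact frankTau_le h1.ne' (h1.trans h2).ne' h2.le
  · exact frankTau_le h1.ne h2.ne' (h1.trans h2).le
end

section
/- Let θ ≠ 0, let λ_U, λ_V > 0 and δ_U, δ_V > 0, let f_U, f_V be the gamma densities with rates λ_U, λ_V and shapes δ_U, δ_V, let F_U, F_V be the corresponding cumulative distribution functions, let C_θ be the Frank copula and c_θ its density. Then for all u, v > 0, the density f_{U,V}(u,v) = c_θ(F_U(u), F_V(v)) · f_U(u) · f_V(v) integrates over rectangles to the Sklar-composed distribution function: ∫₀^u ∫₀^v f_{U,V}(s,t) dt ds = C_θ(F_U(u), F_V(v)). -/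
open MeasureTheory

/-- The gamma density with rate `lam > 0` and shape `delta > 0`. -/
noncomputable def gammaPdf (lam delta t : ℝ) : ℝ :=
  lam ^ delta / Real.Gamma delta * t ^ (delta - 1) * Real.exp (-lam * t)

/-- The gamma cumulative distribution function `F(t) = ∫₀ᵗ f(s) ds`. -/
noncomputable def gammaCdf (lam delta t : ℝ) : ℝ :=
  ∫ s in (0 : ℝ)..t, gammaPdf lam delta s

lemma aux_gammaPdf_int (l d : ℝ) (hl : 0 < l) (hd : 0 < d) :
    IntegrableOn (gammaPdf l d) (Set.Ioi 0) ∧ ∫ t in Set.Ioi (0:ℝ), gammaPdf l d t = 1 := by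
  have h : ∫ t in Set.Ioi (0:ℝ), gammaPdf l d t = 1 := by
    have h0 := Real.integral_rpow_mul_exp_neg_mul_Ioi hd hl
    have hG := (Real.Gamma_pos_of_pos hd).ne'
    have hp := (Real.rpow_pos_of_pos hl d).ne'
    simp only [gammaPdf, mul_assoc, neg_mul]
    rw [integral_const_mul, h0, one_div, Real.inv_rpow hl.le]
    field_simp
  refine ⟨?_, h⟩
  by_contra hc
  rw [integral_undef hc] at h
  norm_num at h

lemma aux_gammaPdf_nonneg (l d : ℝ) (hl : 0 < l) (hd : 0 < d) (t : ℝ) (ht : 0 ≤ t) :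
    0 ≤ gammaPdf l d t := by
  have hG := (Real.Gamma_pos_of_pos hd)
  unfold gammaPdf
  positivity

lemma aux_ii (l d : ℝ) (hl : 0 < l) (hd : 0 < d) (t : ℝ) (ht : 0 ≤ t) :
    IntervalIntegrable (gammaPdf l d) volume 0 t := by
  rw [intervalIntegrable_iff_integrableOn_Ioc_of_le ht]
  exact (aux_gammaPdf_int l d hl hd).1.mono_set Set.Ioc_subset_Ioi_self

lemma aux_cdf_mem (l d : ℝ) (hl : 0 < l) (hd : 0 < d) (t : ℝ) (ht : 0 ≤ t) :
    gammaCdf l d t ∈ Set.Icc (0:ℝ) 1 := by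
  constructor
  · exact intervalIntegral.integral_nonneg ht
      (fun x hx => aux_gammaPdf_nonneg l d hl hd x hx.1)
  · rw [← (aux_gammaPdf_int l d hl hd).2, gammaCdf, intervalIntegral.integral_of_le ht]
    refine setIntegral_mono_set (aux_gammaPdf_int l d hl hd).1 ?_
      Set.Ioc_subset_Ioi_self.eventuallyLE
    filter_upwards [ae_restrict_mem measurableSet_Ioi] with x hx
    exact aux_gammaPdf_nonneg l d hl hd x (le_of_lt hx)

lemma aux_cdf_cont (l d : ℝ) (hl : 0 < l) (hd : 0 < d) (t : ℝ) (ht : 0 ≤ t) :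
    ContinuousOn (gammaCdf l d) (Set.Icc 0 t) := by
  have := intervalIntegral.continuousOn_primitive_interval (a := 0) (b := t)
    (f := gammaPdf l d) (μ := volume) (by
      rw [Set.uIcc_of_le ht, integrableOn_Icc_iff_integrableOn_Ioc]
      exact (aux_gammaPdf_int l d hl hd).1.mono_set Set.Ioc_subset_Ioi_self)
  rwa [Set.uIcc_of_le ht] at this

lemma aux_cdf_deriv (l d : ℝ) (hl : 0 < l) (hd : 0 < d) (t : ℝ) (ht : 0 < t) :
    HasDerivAt (gammaCdf l d) (gammaPdf l d t) t := by
  have hc : ContinuousOn (gammaPdf l d) (Set.Ioi 0) := by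
    intro x hx
    have hx' : x ≠ 0 := ne_of_gt hx
    apply ContinuousAt.continuousWithinAt
    unfold gammaPdf
    have := Real.continuousAt_rpow_const x (d-1) (Or.inl hx')
    fun_prop
  exact intervalIntegral.integral_hasDerivAt_right (aux_ii l d hl hd t ht.le)
    (hc.stronglyMeasurableAtFilter isOpen_Ioi t ht) (hc.continuousAt (Ioi_mem_nhds ht))

lemma aux_subst (l d : ℝ) (hl : 0 < l) (hd : 0 < d) (t : ℝ) (ht : 0 ≤ t) (φ φ' : ℝ → ℝ)
    (h : ∀ x ∈ Set.Icc (0:ℝ) 1, HasDerivAt φ (φ' x) x) (h' : ContinuousOn φ' (Set.Icc 0 1)) :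
    ∫ s in (0:ℝ)..t, φ' (gammaCdf l d s) * gammaPdf l d s = φ (gammaCdf l d t) - φ 0 := by
  have hm : Set.MapsTo (gammaCdf l d) (Set.Icc 0 t) (Set.Icc 0 1) :=
    fun x hx => aux_cdf_mem l d hl hd x hx.1
  have hF := aux_cdf_cont l d hl hd t ht
  have h0 : gammaCdf l d 0 = 0 := by simp [gammaCdf]
  have hφ : ContinuousOn φ (Set.Icc 0 1) :=
    fun x hx => (h x hx).continuousAt.continuousWithinAt
  have := intervalIntegral.integral_eq_sub_of_hasDerivAt_of_le (f := fun s => φ (gammaCdf l d s))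
    (f' := fun s => φ' (gammaCdf l d s) * gammaPdf l d s) ht (hφ.comp hF hm)
    (fun x hx => (h _ (aux_cdf_mem l d hl hd x hx.1.le)).comp x (aux_cdf_deriv l d hl hd x hx.1))
    ((aux_ii l d hl hd t ht).continuousOn_mul (by
      rw [Set.uIcc_of_le ht]
      exact h'.comp hF hm))
  rw [this, h0]

lemma aux_E (θ : ℝ) (hθ : θ ≠ 0) : Real.exp (-θ) - 1 ≠ 0 := by
  intro h
  have : Real.exp (-θ) = 1 := by linarith
  rw [Real.exp_eq_one_iff] at this
  exact hθ (by linarith)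

lemma aux_D (θ a b : ℝ) (hθ : θ ≠ 0) (ha : a ∈ Set.Icc (0:ℝ) 1) (hb : b ∈ Set.Icc (0:ℝ) 1) :
    (Real.exp (-θ) - 1) + (Real.exp (-θ * a) - 1) * (Real.exp (-θ * b) - 1) ≠ 0 := by
  obtain ⟨ha0, ha1⟩ := ha
  obtain ⟨hb0, hb1⟩ := hb
  rcases lt_or_gt_of_ne hθ with h | h
  · have h1 : 1 < Real.exp (-θ) := Real.one_lt_exp_iff.2 (by linarith)
    have h2 : 1 ≤ Real.exp (-θ * a) := Real.one_le_exp (by nlinarith)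
    have h3 : 1 ≤ Real.exp (-θ * b) := Real.one_le_exp (by nlinarith)
    nlinarith [mul_nonneg (sub_nonneg.2 h2) (sub_nonneg.2 h3)]
  · have h1 : Real.exp (-θ) < 1 := by rw [← Real.exp_zero]; exact Real.exp_lt_exp.2 (by linarith)
    have h2 : Real.exp (-θ) ≤ Real.exp (-θ * a) := Real.exp_le_exp.2 (by nlinarith)
    have h3 : Real.exp (-θ) ≤ Real.exp (-θ * b) := Real.exp_le_exp.2 (by nlinarith)
    have h4 : Real.exp (-θ * a) ≤ 1 := Real.exp_le_one_iff.2 (by nlinarith)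
    have h5 : Real.exp (-θ * b) ≤ 1 := Real.exp_le_one_iff.2 (by nlinarith)
    have h6 := Real.exp_pos (-θ)
    have h7 : (1 - Real.exp (-θ * a)) * (1 - Real.exp (-θ * b)) ≤
      (1 - Real.exp (-θ)) * (1 - Real.exp (-θ)) :=
      mul_le_mul (by linarith) (by linarith) (by linarith) (by linarith)
    apply ne_of_lt
    nlinarith

lemma aux_exp (θ x : ℝ) : HasDerivAt (fun y => Real.exp (-θ * y) - 1)
    (-θ * Real.exp (-θ * x)) x := by
  have := (((hasDerivAt_id x).const_mul (-θ)).exp).sub_const 1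
  refine this.congr_deriv ?_
  simp [mul_comm]

/-- partial derivative of the copula -/
noncomputable def auxCa (θ a b : ℝ) : ℝ :=
  Real.exp (-θ * a) * (Real.exp (-θ * b) - 1) /
    ((Real.exp (-θ) - 1) + (Real.exp (-θ * a) - 1) * (Real.exp (-θ * b) - 1))

lemma aux_d1 (θ a b : ℝ) (hθ : θ ≠ 0) (ha : a ∈ Set.Icc (0:ℝ) 1) (hb : b ∈ Set.Icc (0:ℝ) 1) :
    HasDerivAt (fun x => frankCopula θ x b) (auxCa θ a b) a := by
  have hD := aux_D θ a b hθ ha hb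
  have hE := aux_E θ hθ
  have hne : 1 + (Real.exp (-θ * a) - 1) * (Real.exp (-θ * b) - 1) / (Real.exp (-θ) - 1) ≠ 0 := by
    have h2 : 1 + (Real.exp (-θ * a) - 1) * (Real.exp (-θ * b) - 1) / (Real.exp (-θ) - 1) =
      ((Real.exp (-θ) - 1) + (Real.exp (-θ * a) - 1) * (Real.exp (-θ * b) - 1)) /
        (Real.exp (-θ) - 1) := by field_simp
    rw [h2]
    exact div_ne_zero hD hE
  have := ((((((aux_exp θ a).mul_const (Real.exp (-θ * b) - 1)).div_const
    (Real.exp (-θ) - 1)).const_add 1).log hne).const_mul (-(1/θ)))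
  unfold frankCopula
  refine this.congr_deriv ?_
  have h2 : 1 + (Real.exp (-θ * a) - 1) * (Real.exp (-θ * b) - 1) / (Real.exp (-θ) - 1) =
    ((Real.exp (-θ) - 1) + (Real.exp (-θ * a) - 1) * (Real.exp (-θ * b) - 1)) /
      (Real.exp (-θ) - 1) := by field_simp
  rw [h2]
  unfold auxCa
  generalize (Real.exp (-θ) - 1) + (Real.exp (-θ * a) - 1) * (Real.exp (-θ * b) - 1) = D at *
  generalize Real.exp (-θ) - 1 = E at *
  field_simp

lemma aux_d2 (θ a b : ℝ) (hθ : θ ≠ 0) (ha : a ∈ Set.Icc (0:ℝ) 1) (hb : b ∈ Set.Icc (0:ℝ) 1) :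
    HasDerivAt (fun x => auxCa θ a x) (frankDensity θ a b) b := by
  have hD := aux_D θ a b hθ ha hb
  have := ((aux_exp θ b).const_mul (Real.exp (-θ * a))).div
    (((aux_exp θ b).const_mul (Real.exp (-θ * a) - 1)).const_add (Real.exp (-θ) - 1)) hD
  unfold auxCa
  refine this.congr_deriv ?_
  unfold frankDensity
  congr 1
  ring

/-- The joint density `f_{U,V}(s,t) = c_θ(F_U(s),F_V(t))·f_U(s)·f_V(t)` integrates over
rectangles to the Sklar-composed distribution function:
`∫₀ᵘ∫₀ᵛ f_{U,V}(s,t) dt ds = C_θ(F_U(u), F_V(v))` for all `u, v > 0`. -/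
theorem frank_gamma_joint_cdf (θ lamU lamV deltaU deltaV : ℝ)
    (hθ : θ ≠ 0) (hlamU : 0 < lamU) (hlamV : 0 < lamV)
    (hdeltaU : 0 < deltaU) (hdeltaV : 0 < deltaV) :
    ∀ u v : ℝ, 0 < u → 0 < v →
      (∫ s in (0 : ℝ)..u, ∫ t in (0 : ℝ)..v,
          frankDensity θ (gammaCdf lamU deltaU s) (gammaCdf lamV deltaV t) *
            gammaPdf lamU deltaU s * gammaPdf lamV deltaV t) =
        frankCopula θ (gammaCdf lamU deltaU u) (gammaCdf lamV deltaV v) := by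
  intro u v hu hv
  have hv1 := aux_cdf_mem lamV deltaV hlamV hdeltaV v hv.le
  have inner : ∀ s ∈ Set.uIcc 0 u, (∫ t in (0 : ℝ)..v,
          frankDensity θ (gammaCdf lamU deltaU s) (gammaCdf lamV deltaV t) *
            gammaPdf lamU deltaU s * gammaPdf lamV deltaV t) =
      auxCa θ (gammaCdf lamU deltaU s) (gammaCdf lamV deltaV v) * gammaPdf lamU deltaU s := by
    intro s hs
    rw [Set.uIcc_of_le hu.le] at hs
    have hs1 := aux_cdf_mem lamU deltaU hlamU hdeltaU s hs.1
    have h := aux_subst lamV deltaV hlamV hdeltaV v hv.le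
      (fun x => auxCa θ (gammaCdf lamU deltaU s) x)
      (fun x => frankDensity θ (gammaCdf lamU deltaU s) x)
      (fun x hx => aux_d2 θ _ x hθ hs1 hx) (by
        unfold frankDensity
        refine ContinuousOn.div (by fun_prop) (by fun_prop) ?_
        intro x hx
        exact pow_ne_zero 2 (aux_D θ _ x hθ hs1 hx))
    have h0 : auxCa θ (gammaCdf lamU deltaU s) 0 = 0 := by simp [auxCa]
    simp only [h0, sub_zero] at h
    rw [← h, ← intervalIntegral.integral_mul_const]
    congr 1
    ext t
    ring
  rw [intervalIntegral.integral_congr inner]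
  have h := aux_subst lamU deltaU hlamU hdeltaU u hu.le
    (fun x => frankCopula θ x (gammaCdf lamV deltaV v))
    (fun x => auxCa θ x (gammaCdf lamV deltaV v))
    (fun x hx => aux_d1 θ x _ hθ hx hv1) (by
      unfold auxCa
      refine ContinuousOn.div (by fun_prop) (by fun_prop) ?_
      intro x hx
      exact aux_D θ x _ hθ hx hv1)
  rw [h]
  simp [frankCopula]
end

section
/- (Proposition 2, invariance form.) Let θ ≠ 0 and δ_U, δ_V > 0 be fixed. For rates λ_U, λ_V > 0, define f_R(r; λ_U, λ_V) = ∫₀¹ F_V^{-1}(s) · c_θ(F_U(r·F_V^{-1}(s)), s) · f_U(r·F_V^{-1}(s)) ds for r > 0, where f_U, F_U are the gamma density and CDF with rate λ_U and shape δ_U, and F_V, F_V^{-1} are the gamma CDF and its inverse with rate λ_V and shape δ_V, and c_θ is the Frank copula density. If λ_U, λ_V, λ_U', λ_V' > 0 satisfy λ_U/λ_V = λ_U'/λ_V', then f_R(r; λ_U, λ_V) = f_R(r; λ_U', λ_V') for all r > 0; that is, the density of the ratio depends on the rate parameters only through the ratio Λ = λ_U/λ_V. -/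
open MeasureTheory

theorem gammaPdf_scale (k l d t : ℝ) (hk : 0 < k) (hl : 0 < l) (ht : 0 ≤ t) :
    gammaPdf (k * l) d t = k * gammaPdf l d (k * t) := by
  unfold gammaPdf
  have h1 : k ^ d = k * k ^ (d - 1) := by
    rw [Real.rpow_sub_one hk.ne']; field_simp
  rw [Real.mul_rpow hk.le hl.le, Real.mul_rpow hk.le ht, h1,
    show -(k * l) * t = -l * (k * t) by ring]
  ring

theorem gammaCdf_scale (k l d t : ℝ) (hk : 0 < k) (hl : 0 < l) (ht : 0 ≤ t) :
    gammaCdf (k * l) d t = gammaCdf l d (k * t) := by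
  unfold gammaCdf
  have h := intervalIntegral.mul_integral_comp_mul_left (a := 0) (b := t) (f := gammaPdf l d) (c := k)
  rw [mul_zero] at h
  rw [← h, ← intervalIntegral.integral_const_mul]
  apply intervalIntegral.integral_congr
  intro s hs
  rw [Set.uIcc_of_le ht] at hs
  exact gammaPdf_scale k l d s hk hl hs.1

/-- (Proposition 2, invariance form.) The density of the ratio
`f_R(r; λ_U, λ_V) = ∫₀¹ F_V⁻¹(s)·c_θ(F_U(r·F_V⁻¹(s)), s)·f_U(r·F_V⁻¹(s)) ds`
depends on the rate parameters `λ_U, λ_V` only through the ratio `Λ = λ_U/λ_V`: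
if `λ_U/λ_V = λ_U'/λ_V'` then `f_R(r; λ_U, λ_V) = f_R(r; λ_U', λ_V')` for all `r > 0`. -/
theorem ratio_density_depends_only_on_rate_ratio (θ deltaU deltaV : ℝ)
    (hθ : θ ≠ 0) (hdeltaU : 0 < deltaU) (hdeltaV : 0 < deltaV)
    (lamU lamV lamU' lamV' : ℝ)
    (hlamU : 0 < lamU) (hlamV : 0 < lamV) (hlamU' : 0 < lamU') (hlamV' : 0 < lamV')
    (hratio : lamU / lamV = lamU' / lamV')
    (FVinv FVinv' : ℝ → ℝ)
    (hFVinv_pos : ∀ s : ℝ, s ∈ Set.Ioo (0 : ℝ) 1 → 0 < FVinv s)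
    (hFVinv_right : ∀ s : ℝ, s ∈ Set.Ioo (0 : ℝ) 1 → gammaCdf lamV deltaV (FVinv s) = s)
    (hFVinv_left : ∀ t : ℝ, 0 < t → FVinv (gammaCdf lamV deltaV t) = t)
    (hFVinv'_pos : ∀ s : ℝ, s ∈ Set.Ioo (0 : ℝ) 1 → 0 < FVinv' s)
    (hFVinv'_right : ∀ s : ℝ, s ∈ Set.Ioo (0 : ℝ) 1 → gammaCdf lamV' deltaV (FVinv' s) = s)
    (hFVinv'_left : ∀ t : ℝ, 0 < t → FVinv' (gammaCdf lamV' deltaV t) = t) :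
    ∀ r : ℝ, 0 < r →
      (∫ s in (0 : ℝ)..1, FVinv s *
          (frankDensity θ (gammaCdf lamU deltaU (r * FVinv s)) s *
            gammaPdf lamU deltaU (r * FVinv s))) =
      ∫ s in (0 : ℝ)..1, FVinv' s *
          (frankDensity θ (gammaCdf lamU' deltaU (r * FVinv' s)) s *
            gammaPdf lamU' deltaU (r * FVinv' s)) := by
  intro r hr
  obtain ⟨k, hk, hV, hU⟩ : ∃ k : ℝ, 0 < k ∧ lamV' = k * lamV ∧ lamU' = k * lamU := by
    refine ⟨lamV' / lamV, by positivity, by field_simp, ?_⟩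
    rw [div_eq_div_iff hlamV.ne' hlamV'.ne'] at hratio
    field_simp
    linarith
  subst hV hU
  rw [intervalIntegral.integral_of_le zero_le_one, intervalIntegral.integral_of_le zero_le_one,
    integral_Ioc_eq_integral_Ioo, integral_Ioc_eq_integral_Ioo]
  apply setIntegral_congr_fun measurableSet_Ioo
  intro s hs
  have hx := hFVinv'_pos s hs
  have h2 := hFVinv'_right s hs
  rw [gammaCdf_scale k lamV deltaV _ hk hlamV hx.le] at h2
  have h3 := hFVinv_left (k * FVinv' s) (by positivity)
  rw [h2] at h3
  have hrx : 0 ≤ r * FVinv' s := by positivity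
  simp only []
  rw [h3, gammaCdf_scale k lamU deltaU _ hk hlamU hrx, gammaPdf_scale k lamU deltaU _ hk hlamU hrx,
    show r * (k * FVinv' s) = k * (r * FVinv' s) by ring]
  ring
end
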